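/- arXiv:1111.1355 — 4 statements merged into one kernel-verified Lean document; each statement's English description precedes it below -/
import Mathlib

section
/- Let T = T1 T2 ⋯ Tr be the RLZ parse of T with respect to G, and for 1 ≤ j ≤ r+1 let b_j = 1 + |T1| + ⋯ + |T_{j−1}| be the starting position of the j-th phrase (with b_{r+1} = |T|+1). Let P be a nonempty string such that P is a prefix of the suffix of T starting at position b_j (i.e., P occurs in T starting at a phrase boundary), and suppose every symbol of P occurs in G. Let P = P1 P2 ⋯ Ps be the RLZ parse of P with respect to G. Then T_{j+i−1} = P_i for every i with 1 ≤ i ≤ s−1, and P_s is a prefix of T_{j+s−1}. -/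
/-- `L` is the longest prefix of `X` that occurs (as a contiguous substring) in `G`. -/
def IsLongestPrefixIn {α : Type*} (G X L : List α) : Prop :=
  L <+: X ∧ L <:+: G ∧ ∀ L' : List α, L' <+: X → L' <:+: G → L'.length ≤ L.length

/-- `Ts` is the RLZ parse of `T` with respect to `G`: a factorization of `T` into
nonempty phrases such that each phrase is the longest prefix of the remaining
text that occurs in `G`. -/
def IsRLZParse {α : Type*} (G T : List α) (Ts : List (List α)) : Prop :=
  Ts.flatten = T ∧ (∀ p ∈ Ts, p ≠ []) ∧
    ∀ i (h : i < Ts.length), IsLongestPrefixIn G ((Ts.drop i).flatten) (Ts.get ⟨i, h⟩)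

/-- 1-based starting position `b_j` of the `j`-th phrase of the parse
(`bpos Ts (r+1) = |T| + 1`). -/
def bpos {α : Type*} (Ts : List (List α)) (j : ℕ) : ℕ :=
  ((Ts.take (j-1)).flatten).length + 1

theorem rlz_drop {α : Type*} {G T : List α} {Ts : List (List α)} (h : IsRLZParse G T Ts) (k : ℕ) :
    IsRLZParse G (Ts.drop k).flatten (Ts.drop k) := by
  obtain ⟨_, h2, h3⟩ := h
  refine ⟨rfl, fun p hp => h2 p (List.mem_of_mem_drop hp), ?_⟩
  intro i hi
  have := h3 (k + i) (by simp at hi; omega)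
  simpa [List.drop_drop] using this

theorem rlz_core {α : Type*} (G : List α) : ∀ Ps Us : List (List α), Ps ≠ [] →
    IsRLZParse G Ps.flatten Ps → IsRLZParse G Us.flatten Us → Ps.flatten <+: Us.flatten →
    Ps.length ≤ Us.length ∧
    (∀ i, i + 1 < Ps.length → Us[i]! = Ps[i]!) ∧
    Ps[Ps.length - 1]! <+: Us[Ps.length - 1]! := by
  intro Ps
  induction Ps with
  | nil => intro Us h; exact absurd rfl h
  | cons p Ps ih =>
    intro Us _ hP hU hpre
    have hp : p ≠ [] := hP.2.1 p (by simp)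
    cases Us with
    | nil => simp [hp] at hpre
    | cons u Us =>
      have hPl := hP.2.2 0 (by simp)
      have hUl := hU.2.2 0 (by simp)
      have hP' := rlz_drop hP 1
      have hU' := rlz_drop hU 1
      simp only [List.drop_zero, List.drop_succ_cons, List.get_eq_getElem,
        List.getElem_cons_zero] at hPl hUl hP' hU'
      have hpU : p <+: (u :: Us).flatten := hPl.1.trans hpre
      have hpu : p <+: u :=
        List.prefix_of_prefix_length_le hpU hUl.1 (hUl.2.2 p hpU hPl.2.1)
      by_cases hPs : Ps = []
      · subst hPs
        simpa using hpu
      · have hu : p = u := by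
          rcases List.prefix_or_prefix_of_prefix hUl.1 hpre with h | h
          · exact hpu.eq_of_length_le (hPl.2.2 u h hUl.2.1)
          · exfalso
            have hle := hPl.2.2 _ (List.prefix_refl _) (h.isInfix.trans hUl.2.1)
            obtain ⟨q, Qs, rfl⟩ := List.exists_cons_of_ne_nil hPs
            have hq : q ≠ [] := hP.2.1 q (by simp)
            have := List.length_pos_iff.2 hq
            simp only [List.flatten_cons, List.length_append] at hle
            omega
        subst hu
        have hpre' : Ps.flatten <+: Us.flatten := by
          simpa [List.prefix_append_right_inj] using hpre
        obtain ⟨h1, h2, h3⟩ := ih Us hPs hP' hU' hpre'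
        have hlen := List.length_pos_iff.2 hPs
        refine ⟨by simpa using h1, ?_, ?_⟩
        · intro i hi
          cases i with
          | zero => simp
          | succ i =>
            have := h2 i (by simp at hi; omega)
            simpa using this
        · obtain ⟨n, hn⟩ : ∃ n, Ps.length = n + 1 := ⟨Ps.length - 1, by omega⟩
          simpa [hn] using h3

/-- if a nonempty string `P`, all of whose symbols occur in `G`, is a
prefix of the suffix of `T` starting at the `j`-th phrase boundary `b_j`, and
`P = P₁ ⋯ P_s` is the RLZ parse of `P` w.r.t. `G`, then `T_{j+i-1} = P_i` for
`1 ≤ i ≤ s-1` and `P_s` is a prefix of `T_{j+s-1}`. -/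
theorem rlz_parse_prefix_agrees {α : Type*} (G T P : List α)
    (Ts Ps : List (List α)) (hT : IsRLZParse G T Ts)
    (j : ℕ) (hj1 : 1 ≤ j) (hj2 : j ≤ Ts.length + 1)
    (hP : P ≠ []) (hpre : P <+: T.drop (bpos Ts j - 1))
    (hsym : ∀ c ∈ P, c ∈ G)
    (hPs : IsRLZParse G P Ps) :
    (j - 1) + Ps.length ≤ Ts.length ∧
    (∀ i, 1 ≤ i → i ≤ Ps.length - 1 → Ts[(j - 1) + (i - 1)]! = Ps[i - 1]!) ∧
    Ps[Ps.length - 1]! <+: Ts[(j - 1) + (Ps.length - 1)]! := by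
  have hne : Ps ≠ [] := by
    rintro rfl
    exact hP (by simpa using hPs.1.symm)
  have hdrop : T.drop (bpos Ts j - 1) = (Ts.drop (j - 1)).flatten := by
    have h : T = (Ts.take (j - 1)).flatten ++ (Ts.drop (j - 1)).flatten := by
      rw [← List.flatten_append, List.take_append_drop, hT.1]
    rw [h]
    simp [bpos]
  rw [hdrop] at hpre
  have hPf := hPs.1
  subst hPf
  obtain ⟨h1, h2, h3⟩ := rlz_core G Ps _ hne hPs (rlz_drop hT (j - 1)) hpre
  have hget : ∀ i, (Ts.drop (j - 1))[i]! = Ts[(j - 1) + i]! := by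
    intro i
    simp [List.getElem!_eq_getElem?_getD, List.getElem?_drop]
  have hlen := List.length_pos_iff.2 hne
  simp only [hget] at h2 h3
  rw [List.length_drop] at h1
  exact ⟨by omega, fun i hi hi' => h2 (i - 1) (by omega), h3⟩
end

section
/- Let T = T1 T2 ⋯ Tr be the RLZ parse of T with respect to G, let b_j = 1 + |T1| + ⋯ + |T_{j−1}| be the starting position of the j-th phrase, and let P be a string of length m ≥ 2. Call an occurrence of P at position p in T primary if it contains a phrase boundary in its interior, i.e., there exists j with p < b_j ≤ p + m − 1. Then the map (j, i) ↦ p = b_j − i + 1 is a bijection from the set of pairs (j, i) with 2 ≤ j ≤ r and 2 ≤ i ≤ m such that P[1..i−1] is a suffix of the phrase T_{j−1} and P[i..m] is a prefix of the suffix of T starting at position b_j, onto the set of positions p of primary occurrences of P in T; under this bijection, b_j is the first phrase boundary inside the occurrence at p. -/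
theorem bpos_succ_aux {α : Type*} (Ts : List (List α)) (k : ℕ) (h : k < Ts.length) :
    bpos Ts (k+2) = bpos Ts (k+1) + (Ts[k]!).length := by
  have e : k + 2 - 1 = k + 1 := rfl
  have e' : k + 1 - 1 = k := rfl
  simp only [bpos, e, e']
  rw [List.take_succ_eq_append_getElem h, getElem!_pos Ts k h]
  simp only [List.flatten_append, List.length_append, List.flatten_cons, List.flatten_nil,
    List.append_nil]
  omega

theorem drop_bpos_aux {α : Type*} (Ts : List (List α)) (k : ℕ) :
    Ts.flatten.drop (bpos Ts (k+1) - 1) = (Ts.drop k).flatten := by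
  have e' : k + 1 - 1 = k := rfl
  simp only [bpos, e', Nat.add_sub_cancel]
  conv_lhs => rw [← List.take_append_drop k Ts]
  rw [List.flatten_append]
  simp

theorem drop_bpos_split {α : Type*} (Ts : List (List α)) (k : ℕ) (h : k < Ts.length) :
    Ts.flatten.drop (bpos Ts (k+1) - 1) = Ts[k]! ++ Ts.flatten.drop (bpos Ts (k+2) - 1) := by
  rw [drop_bpos_aux, drop_bpos_aux, List.drop_eq_getElem_cons h, getElem!_pos Ts k h,
    List.flatten_cons]

theorem bpos_mono_aux {α : Type*} (Ts : List (List α)) {a b : ℕ} (h : a ≤ b) :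
    bpos Ts a ≤ bpos Ts b := by
  have h1 : Ts.take (a-1) <+: Ts.take (b-1) :=
    List.take_prefix_take_left (by omega)
  obtain ⟨t, ht⟩ := h1
  simp only [bpos]
  rw [← ht]
  simp

theorem bpos_lt_aux {α : Type*} (Ts : List (List α)) {a b : ℕ} (h : bpos Ts a < bpos Ts b) :
    a < b := by
  by_contra hc
  have := bpos_mono_aux Ts (not_lt.mp hc)
  omega

theorem pair_key {α : Type*} (Ts : List (List α)) (P : List α) (j i : ℕ) (h1 : 2 ≤ j)
    (h2 : j ≤ Ts.length) (h3 : 2 ≤ i) (h4 : i ≤ P.length)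
    (h5 : P.take (i - 1) <:+ Ts[j - 2]!)
    (h6 : P.drop (i - 1) <+: Ts.flatten.drop (bpos Ts j - 1)) :
    ∃ p, p + i = bpos Ts j + 1 ∧ bpos Ts (j-1) ≤ p ∧ P <+: Ts.flatten.drop (p - 1) := by
  obtain ⟨k, rfl⟩ : ∃ k, j = k + 2 := ⟨j - 2, by omega⟩
  have hk : k < Ts.length := by omega
  have hs := bpos_succ_aux Ts k hk
  have hd := drop_bpos_split Ts k hk
  have e : k + 2 - 2 = k := rfl
  have e' : k + 2 - 1 = k + 1 := rfl
  rw [e] at h5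
  rw [e']
  obtain ⟨A, hA⟩ := h5
  have hlen := congrArg List.length hA
  simp only [List.length_append, List.length_take] at hlen
  rw [min_eq_left (by omega)] at hlen
  have hb : 1 ≤ bpos Ts (k+1) := by simp [bpos]
  refine ⟨bpos Ts (k+1) + A.length, by omega, by omega, ?_⟩
  have e2 : bpos Ts (k+1) + A.length - 1 = (bpos Ts (k+1) - 1) + A.length := by omega
  rw [e2, ← List.drop_drop, hd, ← hA, List.append_assoc, List.drop_left]
  conv_lhs => rw [← List.take_append_drop (i-1) P]
  exact (List.prefix_append_right_inj _).mpr h6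

/-- the map `(j, i) ↦ p = b_j - i + 1` is a bijection from the set of
pairs `(j, i)` with `2 ≤ j ≤ r`, `2 ≤ i ≤ m`, `P[1..i-1]` a suffix of `T_{j-1}` and
`P[i..m]` a prefix of the suffix of `T` starting at `b_j`, onto the set of positions
of primary occurrences of `P` in `T` (occurrences containing a phrase boundary in
their interior); moreover, under this map `b_j` is the first phrase boundary inside
the occurrence. Positions are 1-based. -/
theorem rlz_primary_occurrences_bijection {α : Type*} (G T P : List α)
    (Ts : List (List α)) (hT : IsRLZParse G T Ts)
    (m : ℕ) (hm : P.length = m) (hm2 : 2 ≤ m) :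
    Set.BijOn (fun ji : ℕ × ℕ => bpos Ts ji.1 + 1 - ji.2)
      {ji : ℕ × ℕ | 2 ≤ ji.1 ∧ ji.1 ≤ Ts.length ∧ 2 ≤ ji.2 ∧ ji.2 ≤ m ∧
        P.take (ji.2 - 1) <:+ Ts[ji.1 - 2]! ∧
        P.drop (ji.2 - 1) <+: T.drop (bpos Ts ji.1 - 1)}
      {p : ℕ | 1 ≤ p ∧ P <+: T.drop (p - 1) ∧
        ∃ j, 1 ≤ j ∧ j ≤ Ts.length + 1 ∧ p < bpos Ts j ∧ bpos Ts j ≤ p + m - 1} ∧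
    (∀ ji : ℕ × ℕ,
      ji ∈ {ji : ℕ × ℕ | 2 ≤ ji.1 ∧ ji.1 ≤ Ts.length ∧ 2 ≤ ji.2 ∧ ji.2 ≤ m ∧
        P.take (ji.2 - 1) <:+ Ts[ji.1 - 2]! ∧
        P.drop (ji.2 - 1) <+: T.drop (bpos Ts ji.1 - 1)} →
      ∀ j', 1 ≤ j' → j' ≤ Ts.length + 1 →
        bpos Ts ji.1 + 1 - ji.2 < bpos Ts j' →
        bpos Ts j' ≤ (bpos Ts ji.1 + 1 - ji.2) + m - 1 →
        bpos Ts ji.1 ≤ bpos Ts j') := by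
  obtain ⟨rfl, -, -⟩ := hT
  subst hm
  refine ⟨⟨?_, ?_, ?_⟩, ?_⟩
  · rintro ⟨j, i⟩ ⟨h1, h2, h3, h4, h5, h6⟩
    simp only at h1 h2 h3 h4 h5 h6
    obtain ⟨p, hp, hp1, hp2⟩ := pair_key Ts P j i h1 h2 h3 h4 h5 h6
    have hb : 1 ≤ bpos Ts (j-1) := by simp [bpos]
    have e : bpos Ts j + 1 - i = p := by omega
    simp only [Set.mem_ofPred_eq, e]
    exact ⟨by omega, hp2, j, by omega, by omega, by omega, by omega⟩
  · rintro ⟨j, i⟩ ⟨h1, h2, h3, h4, h5, h6⟩ ⟨j', i'⟩ ⟨h1', h2', h3', h4', h5', h6'⟩ heq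
    simp only at h1 h2 h3 h4 h5 h6 h1' h2' h3' h4' h5' h6' heq
    obtain ⟨p, hp, hp1, -⟩ := pair_key Ts P j i h1 h2 h3 h4 h5 h6
    obtain ⟨p', hp', hp1', -⟩ := pair_key Ts P j' i' h1' h2' h3' h4' h5' h6'
    have a1 : j - 1 < j' := bpos_lt_aux Ts (by omega)
    have a2 : j' - 1 < j := bpos_lt_aux Ts (by omega)
    obtain rfl : j = j' := by omega
    obtain rfl : i = i' := by omega
    rfl
  · rintro p ⟨hp, hP, hj⟩
    have hex : ∃ j, p < bpos Ts j := by
      obtain ⟨j, -, -, h, -⟩ := hj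
      exact ⟨j, h⟩
    classical
    obtain ⟨j, hlt, hmin⟩ : ∃ j, p < bpos Ts j ∧ ∀ k < j, bpos Ts k ≤ p :=
      ⟨Nat.find hex, Nat.find_spec hex, fun k hk => not_lt.mp (Nat.find_min hex hk)⟩
    have hle : bpos Ts j ≤ p + P.length - 1 := by
      obtain ⟨j0, -, -, h, h'⟩ := hj
      have : j ≤ j0 := by
        by_contra hc
        have := hmin j0 (by omega)
        omega
      have := bpos_mono_aux Ts this
      omega
    have hj2 : 2 ≤ j := by
      by_contra hc
      have : j - 1 = 0 := by omega
      simp [bpos, this] at hlt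
      omega
    have hPl := hP.length_le
    rw [List.length_drop] at hPl
    have hr : bpos Ts (Ts.length + 1) = Ts.flatten.length + 1 := by simp [bpos]
    have hjr : j < Ts.length + 1 := bpos_lt_aux Ts (by omega)
    obtain ⟨k, rfl⟩ : ∃ k, j = k + 2 := ⟨j - 2, by omega⟩
    have hk : k < Ts.length := by omega
    have hs := bpos_succ_aux Ts k hk
    have hd := drop_bpos_split Ts k hk
    have hm1 := hmin (k+1) (by omega)
    have hb : 1 ≤ bpos Ts (k+1) := by simp [bpos]
    have e2 : p - 1 = (bpos Ts (k+1) - 1) + (p - bpos Ts (k+1)) := by omega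
    have hP' := hP
    rw [e2, ← List.drop_drop, hd, List.drop_append_of_le_length (by omega)] at hP'
    have hl : (Ts[k]!.drop (p - bpos Ts (k+1))).length = bpos Ts (k+2) - p := by
      rw [List.length_drop]; omega
    have hpre : Ts[k]!.drop (p - bpos Ts (k+1)) <+: P :=
      List.prefix_of_prefix_length_le (List.prefix_append _ _) hP' (by omega)
    obtain ⟨Q, hQ⟩ := hpre
    refine ⟨(k+2, bpos Ts (k+2) - p + 1), ⟨hj2, by simp only; omega, by simp only; omega,
      by simp only; omega, ?_, ?_⟩, by simp only; omega⟩
    · simp only [Nat.add_sub_cancel]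
      rw [← hQ, ← hl, List.take_left]
      exact List.drop_suffix _ _
    · simp only [Nat.add_sub_cancel]
      rw [← hQ] at hP'
      rw [← hl, ← hQ, List.drop_left]
      exact (List.prefix_append_right_inj _).mp hP'
  · rintro ⟨j, i⟩ ⟨h1, h2, h3, h4, h5, h6⟩ j' hj1 hj2 hlt hle
    simp only at h1 h2 h3 h4 h5 h6 hlt hle ⊢
    obtain ⟨p, hp, hp1, -⟩ := pair_key Ts P j i h1 h2 h3 h4 h5 h6
    have a1 : j - 1 < j' := bpos_lt_aux Ts (by omega)
    exact bpos_mono_aux Ts (by omega)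
end

section
/- Let G be a string of length n whose suffixes are pairwise distinct. For nonempty substrings w1 and w2 of G, if w1 is lexicographically strictly smaller than w2, then code(w1) < code(w2), where code(w) = q(w)·n + |w| and q(w) is the rank of the lexicographically smallest suffix of G having w as a prefix. In particular, code is injective on the set of nonempty substrings of G, and code respects the lexicographic ordering of substrings. -/
/-- The rank (counting from 1) of the suffix of `G` starting at (0-based) position
`x` in the lexicographic ordering of all suffixes of `G`. -/
noncomputable def suffixRank {α : Type*} [LinearOrder α] (G : List α) (x : ℕ) : ℕ :=
  1 + {y : ℕ | y < G.length ∧ List.Lex (· < ·) (G.drop y) (G.drop x)}.ncard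

/-- `q(w)`: the rank of the lexicographically smallest suffix of `G` having `w`
as a prefix (equivalently, the smallest rank of a suffix with prefix `w`). -/
noncomputable def qRank {α : Type*} [LinearOrder α] (G w : List α) : ℕ :=
  sInf (suffixRank G '' {x : ℕ | x < G.length ∧ w <+: G.drop x})

/-- `code(w) = q(w)·n + |w|` where `n = |G|`. -/
noncomputable def code {α : Type*} [LinearOrder α] (G w : List α) : ℕ :=
  qRank G w * G.length + w.length

theorem lex_cases_aux {α : Type*} [LinearOrder α] {w1 w2 : List α}
    (h : List.Lex (· < ·) w1 w2) :
    (w1 <+: w2 ∧ w1.length < w2.length) ∨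
      ∀ a b, List.Lex (· < ·) (w1 ++ a) (w2 ++ b) := by
  induction h with
  | nil => left; simp
  | rel h => right; intro a b; exact List.Lex.rel h
  | cons h ih =>
    rcases ih with ⟨h1, h2⟩ | h1
    · left
      exact ⟨by simpa using h1, by simpa using h2⟩
    · right; intro a b; exact List.Lex.cons (h1 a b)

theorem suffixRank_lt_aux {α : Type*} [LinearOrder α] (G : List α) (x y : ℕ)
    (hx : x < G.length) (h : List.Lex (· < ·) (G.drop x) (G.drop y)) :
    suffixRank G x < suffixRank G y := by
  unfold suffixRank
  have hfin : {z : ℕ | z < G.length ∧ List.Lex (· < ·) (G.drop z) (G.drop y)}.Finite :=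
    (Set.finite_lt_nat G.length).subset (fun z hz => hz.1)
  have := Set.ncard_lt_ncard (s := {z : ℕ | z < G.length ∧
    List.Lex (· < ·) (G.drop z) (G.drop x)}) ?_ hfin
  · omega
  · refine (Set.ssubset_iff_of_subset ?_).2 ⟨x, ⟨hx, h⟩, ?_⟩
    · rintro z ⟨hz, hz2⟩
      have h1 : G.drop z < G.drop x := hz2
      have h2 : G.drop x < G.drop y := h
      exact ⟨hz, lt_trans h1 h2⟩
    · rintro ⟨-, h1⟩
      have h1 : G.drop x < G.drop x := h1
      exact lt_irrefl _ h1

theorem occ_aux {α : Type*} (G w : List α) (hw : w ≠ []) (h : w <:+: G) :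
    ∃ x, x < G.length ∧ w <+: G.drop x := by
  obtain ⟨s, t, rfl⟩ := h
  have := List.length_pos_of_ne_nil hw
  refine ⟨s.length, by simp; omega, t, by simp⟩

theorem code_lt_aux {α : Type*} [LinearOrder α] (G w1 w2 : List α)
    (h1 : w1 ≠ []) (g1 : w1 <:+: G) (h2 : w2 ≠ []) (g2 : w2 <:+: G)
    (h : List.Lex (· < ·) w1 w2) : code G w1 < code G w2 := by
  obtain ⟨x1, o1⟩ := occ_aux G w1 h1 g1
  obtain ⟨x2, o2⟩ := occ_aux G w2 h2 g2
  obtain ⟨y, ⟨hy, p2⟩, e2⟩ : qRank G w2 ∈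
      suffixRank G '' {x : ℕ | x < G.length ∧ w2 <+: G.drop x} :=
    Nat.sInf_mem ⟨_, x2, o2, rfl⟩
  have hle : ∀ x, x < G.length → w1 <+: G.drop x → qRank G w1 ≤ suffixRank G x :=
    fun x hx hp => Nat.sInf_le ⟨x, ⟨hx, hp⟩, rfl⟩
  unfold code
  rcases lex_cases_aux h with ⟨hp, hl⟩ | hlex
  · have := hle y hy (hp.trans p2)
    rw [e2] at this
    have := Nat.mul_le_mul_right G.length this
    omega
  · have hq := hle x1 o1.1 o1.2
    have hr : suffixRank G x1 < suffixRank G y := by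
      apply suffixRank_lt_aux G x1 y o1.1
      obtain ⟨a, ha⟩ := o1.2
      obtain ⟨b, hb⟩ := p2
      rw [← ha, ← hb]
      exact hlex a b
    have h3 : qRank G w1 + 1 ≤ qRank G w2 := by omega
    have h4 := Nat.mul_le_mul_right G.length h3
    have h5 := g1.length_le
    have h6 := List.length_pos_of_ne_nil h2
    rw [Nat.add_mul] at h4
    omega

/-- for nonempty substrings `w₁, w₂` of a string `G` of length `n`
with pairwise distinct suffixes, `w₁ <_lex w₂` implies `code(w₁) < code(w₂)`;
in particular `code` is injective on nonempty substrings of `G` and respects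
their lexicographic order. -/
theorem code_respects_lex {α : Type*} [LinearOrder α] (G : List α) (n : ℕ)
    (hn : G.length = n)
    (hdist : ∀ x y, x < n → y < n → G.drop x = G.drop y → x = y) :
    (∀ w1 w2 : List α, w1 ≠ [] → w1 <:+: G → w2 ≠ [] → w2 <:+: G →
      List.Lex (· < ·) w1 w2 → code G w1 < code G w2) ∧
    Set.InjOn (code G) {w : List α | w ≠ [] ∧ w <:+: G} := by
  refine ⟨fun w1 w2 h1 g1 h2 g2 h => code_lt_aux G w1 w2 h1 g1 h2 g2 h, ?_⟩
  rintro w1 ⟨h1, g1⟩ w2 ⟨h2, g2⟩ he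
  rcases lt_trichotomy w1 w2 with h | h | h
  · exact absurd he (code_lt_aux G w1 w2 h1 g1 h2 g2 h).ne
  · exact h
  · exact absurd he (code_lt_aux G w2 w1 h2 g2 h1 g1 h).ne'
end

section
/- Let T = T1 T2 ⋯ Tr be the RLZ parse of T with respect to G, let b_j = 1 + |T1| + ⋯ + |T_{j−1}| be the starting position of the j-th phrase, and let P be a string of length m every symbol of which occurs in G. Fix i with 1 ≤ i ≤ m, and let ℓ(i) be the integer such that P[i..ℓ(i)−1] is the longest prefix of P[i..m] that occurs in G. Suppose ℓ(i) ≤ m (i.e., P[i..m] itself does not occur in G). Then for every j with 1 ≤ j ≤ r: the suffix of T starting at position b_j has P[i..m] as a prefix if and only if the phrase Tj equals P[i..ℓ(i)−1] exactly and the suffix of T starting at position b_{j+1} has P[ℓ(i)..m] as a prefix. -/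
theorem rlz_step_aux {α : Type*} (G A S L R : List α) (hR : R ≠ [])
    (hA : IsLongestPrefixIn G (A ++ S) A) (hL : IsLongestPrefixIn G (L ++ R) L) :
    L ++ R <+: A ++ S ↔ A = L ∧ R <+: S := by
  obtain ⟨_, hA2, hA3⟩ := hA
  obtain ⟨_, hL2, hL3⟩ := hL
  constructor
  · intro h
    have hLA : L <+: A ++ S := (List.prefix_append L R).trans h
    have h1 := hA3 L hLA hL2
    have hAA : A <+: A ++ S := List.prefix_append A S
    have hR' : 0 < R.length := List.length_pos_iff.mpr hR
    have h2 : A.length ≤ L.length := by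
      rcases le_total A.length (L ++ R).length with h3 | h3
      · exact hL3 A (List.prefix_of_prefix_length_le hAA h h3) hA2
      · have h4 : L ++ R <+: A := List.prefix_of_prefix_length_le h hAA h3
        have h5 := hL3 _ (List.prefix_refl _) (h4.isInfix.trans hA2)
        simp at h5
        exact absurd h5 hR
    have h6 : A = L :=
      (List.prefix_of_prefix_length_le hAA hLA h2).eq_of_length (le_antisymm h2 h1)
    subst h6
    exact ⟨rfl, (List.prefix_append_right_inj A).mp h⟩
  · rintro ⟨rfl, h⟩
    exact (List.prefix_append_right_inj A).mpr h

theorem rlz_drop_flatten {α : Type*} (Ts : List (List α)) (k : ℕ) :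
    Ts.flatten.drop (Ts.take k).flatten.length = (Ts.drop k).flatten := by
  conv_lhs => rw [← List.take_append_drop k Ts, List.flatten_append]
  simp

/-- if `P[i..ℓ-1]` is the longest prefix of `P[i..m]` occurring in `G`
and `ℓ ≤ m` (so `P[i..m]` itself does not occur in `G`), then for every phrase `j`,
the suffix of `T` starting at `b_j` has `P[i..m]` as a prefix iff `T_j = P[i..ℓ-1]`
exactly and the suffix of `T` starting at `b_{j+1}` has `P[ℓ..m]` as a prefix. -/
theorem rlz_backward_search_step {α : Type*} (G T P : List α)
    (Ts : List (List α)) (hparse : IsRLZParse G T Ts)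
    (m : ℕ) (hm : P.length = m) (hsym : ∀ c ∈ P, c ∈ G)
    (i ℓ : ℕ) (hi1 : 1 ≤ i) (him : i ≤ m) (hiℓ : i ≤ ℓ)
    (hℓ : IsLongestPrefixIn G (P.drop (i - 1)) ((P.take (ℓ - 1)).drop (i - 1)))
    (hℓm : ℓ ≤ m) :
    ∀ j, 1 ≤ j → j ≤ Ts.length →
      (P.drop (i - 1) <+: T.drop (bpos Ts j - 1) ↔
        Ts[j - 1]! = (P.take (ℓ - 1)).drop (i - 1) ∧
          P.drop (ℓ - 1) <+: T.drop (bpos Ts (j + 1) - 1)) := by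
  intro j hj1 hj
  obtain ⟨rfl, -, hp⟩ := hparse
  have hlt : j - 1 < Ts.length := by omega
  have hA := hp (j - 1) hlt
  have hS : (Ts.drop (j - 1)).flatten = Ts[j - 1] ++ (Ts.drop j).flatten := by
    rw [List.drop_eq_getElem_cons hlt, List.flatten_cons, Nat.sub_add_cancel hj1]
  have hX : P.drop (i - 1) = (P.take (ℓ - 1)).drop (i - 1) ++ P.drop (ℓ - 1) := by
    conv_lhs => rw [← List.take_append_drop (ℓ - 1) P]
    rw [List.drop_append_of_le_length]
    simp
    omega
  have hR : P.drop (ℓ - 1) ≠ [] := by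
    rw [Ne, List.drop_eq_nil_iff]
    omega
  have e1 : bpos Ts j - 1 = (Ts.take (j - 1)).flatten.length := rfl
  have e2 : bpos Ts (j + 1) - 1 = (Ts.take j).flatten.length := rfl
  rw [e1, e2, rlz_drop_flatten, rlz_drop_flatten, getElem!_pos Ts (j - 1) hlt, hS]
  rw [hS] at hA
  rw [hX] at hℓ
  conv_lhs => rw [hX]
  exact rlz_step_aux G _ _ _ _ hR hA hℓ
end
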